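/- The density of the m-NED in stationarity satisfies Z_{n,m} · π(η_1 = 1) = ∑_{β ∈ Ω, β_1 = 1} W(β) = ∑_{k=1}^{n} ∑_{(M,N) ∈ 𝒞_{n,k}} ∑_{(x_1,…,x_{m−2}) ∈ 𝒯_M} k!/(x_1!⋯x_{m−2}!·N!·(k−N−x_1−⋯−x_{m−2})!) · C(n−k−M−(m−2)N−1, N−1) · p1^k · (1−p1)^{M+(m−1)N} · p2^{−N}. -/

import Mathlib

open Finset

/-- Per-site transition factor `q_i(α, b)` of the m-NED: if the window
`(α_i, …, α_{i+m-1})` is `0^m` the site becomes `1` with probability `p1`;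
if it is `0^{m-1}1` it becomes `1` with probability `1 - p2`; otherwise it
becomes `0` with probability `1`. -/
noncomputable def nedQ (n m : ℕ) (p1 p2 : ℝ) (α : ZMod n → Bool) (i : ZMod n) (b : Bool) : ℝ :=
  if ∀ j : Fin m, α (i + (j.val : ZMod n)) = false then
    if b then p1 else 1 - p1
  else if (∀ j : Fin (m - 1), α (i + (j.val : ZMod n)) = false) ∧
      α (i + ((m - 1 : ℕ) : ZMod n)) = true then
    if b then 1 - p2 else p2
  else if b then 0 else 1

/-- Transition probability `P(α → β)` of the m-NED on the ring of `n` sites. -/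
noncomputable def nedP (n m : ℕ) [NeZero n] (p1 p2 : ℝ) (α β : ZMod n → Bool) : ℝ :=
  ∏ i : ZMod n, nedQ n m p1 p2 α i (β i)

/-- `N₁(β)`: the number of sites carrying the symbol `1`. -/
def nedN1 (n : ℕ) [NeZero n] (β : ZMod n → Bool) : ℕ :=
  (univ.filter fun i : ZMod n => β i = true).card

/-- `N_{10^r 1}(β)`: the number of occurrences of the subsequence `1 0^r 1`. -/
def nedN10r1 (n : ℕ) [NeZero n] (r : ℕ) (β : ZMod n → Bool) : ℕ :=
  (univ.filter fun i : ZMod n =>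
    β i = true ∧ (∀ j : Fin r, β (i + ((j.val + 1 : ℕ) : ZMod n)) = false) ∧
      β (i + ((r + 1 : ℕ) : ZMod n)) = true).card

/-- `N_{0^r 1}(β)`: the number of occurrences of the subsequence `0^r 1`. -/
def nedN0r1 (n : ℕ) [NeZero n] (r : ℕ) (β : ZMod n → Bool) : ℕ :=
  (univ.filter fun i : ZMod n =>
    (∀ j : Fin r, β (i + (j.val : ZMod n)) = false) ∧
      β (i + ((r : ℕ) : ZMod n)) = true).card

/-- The stationary weight
`W(β) = p1^{N₁(β)} (1-p1)^{∑_{r=1}^{m-2} r N_{10^r1}(β) + (m-1) N_{0^{m-1}1}(β)} p2^{-N_{0^{m-1}1}(β)}`. -/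
noncomputable def nedW (n m : ℕ) [NeZero n] (p1 p2 : ℝ) (β : ZMod n → Bool) : ℝ :=
  p1 ^ nedN1 n β *
    (1 - p1) ^ ((∑ r ∈ Finset.Icc 1 (m - 2), r * nedN10r1 n r β) +
      (m - 1) * nedN0r1 n (m - 1) β) / p2 ^ nedN0r1 n (m - 1) β

/-- The partition function `Z_{n,m} = ∑_{β ∈ Ω} W(β)`. -/
noncomputable def nedZ (n m : ℕ) [NeZero n] (p1 p2 : ℝ) : ℝ :=
  ∑ β : ZMod n → Bool, nedW n m p1 p2 β

/-- Integer binomial coefficient with the convention `C(-1,-1) = 1`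
(and value `0` when the lower index is otherwise negative). -/
def ichoose (a b : ℤ) : ℕ :=
  if a = -1 ∧ b = -1 then 1 else if 0 ≤ b then Nat.choose a.toNat b.toNat else 0

/-- The multinomial coefficient `k! / (x₁! ⋯ x_t! · N! · (k - N - ∑ x)!)`, written as the
product of successive binomial coefficients (hence `0` whenever `N + ∑ x > k`). -/
def multChain {t : ℕ} (k : ℕ) (x : Fin t → ℕ) (N : ℕ) : ℕ :=
  (∏ j : Fin t, Nat.choose (k - ∑ s ∈ univ.filter (fun s => s < j), x s) (x j)) *
    Nat.choose (k - ∑ s, x s) N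

/-- `𝒯_M`: the tuples `(x_1, …, x_{m-2}) ∈ {0,1,…,k}^{m-2}` with `∑_{s=1}^{m-2} s·x_s = M`. -/
def nedT (m k M : ℕ) : Finset (Fin (m - 2) → ℕ) :=
  (Fintype.piFinset fun _ : Fin (m - 2) => Finset.range (k + 1)).filter fun x =>
    ∑ s, (s.val + 1) * x s = M

/-- `𝒞_{n,k}`: the pairs `(M, N)` of nonnegative integers with
`M ∈ {0,…,n-k-m+1} ∪ {n-k}`, `(m-1)·N + M ≤ n-k`, and `N = 0 ↔ M = n-k`. -/
def nedC (n m k : ℕ) : Finset (ℕ × ℕ) :=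
  (Finset.range (n + 1) ×ˢ Finset.range (n + 1)).filter fun MN =>
    (MN.1 + (m - 1) ≤ n - k ∨ MN.1 = n - k) ∧
      MN.2 * (m - 1) + MN.1 ≤ n - k ∧ (MN.2 = 0 ↔ MN.1 = n - k)

/-- `|Pos_{a₁b₁,a₂b₂}|`: the number of sites `i` with `(α_i, α_{i+1}) = (a₁, b₁)` and
`(β_i, β_{i+1}) = (a₂, b₂)`. -/
def posCount (n : ℕ) [NeZero n] (α β : ZMod n → Bool) (a1 b1 a2 b2 : Bool) : ℕ :=
  (univ.filter fun i : ZMod n =>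
    α i = a1 ∧ α (i + 1) = b1 ∧ β i = a2 ∧ β (i + 1) = b2).card

/-- The explicit sequence `Z_0 = 2`,
`Z_n = 1 + ∑_{k=1}^n ∑_{j=0}^{n-k} (n/k)·C(k,j)·C(n-k-1,j-1)·p1^k·q2^j` for `n ≥ 1`,
with `q2 = (1-p1)/p2` and the convention `C(-1,-1) = 1`. -/
noncomputable def Zseq (p1 p2 : ℝ) (n : ℕ) : ℝ :=
  if n = 0 then 2
  else 1 + ∑ k ∈ Finset.Icc 1 n, ∑ j ∈ Finset.range (n - k + 1),
    (n : ℝ) / k * (Nat.choose k j : ℝ) * (ichoose ((n : ℤ) - k - 1) ((j : ℤ) - 1) : ℝ) *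
      p1 ^ k * ((1 - p1) / p2) ^ j

/-- The unnormalized density sequence `D_0 = 0`,
`D_n = ∑_{k=1}^n ∑_{j=0}^{n-k} C(k,j)·C(n-k-1,j-1)·p1^k·q2^j` for `n ≥ 1`. -/
noncomputable def Dseq (p1 p2 : ℝ) (n : ℕ) : ℝ :=
  if n = 0 then 0
  else ∑ k ∈ Finset.Icc 1 n, ∑ j ∈ Finset.range (n - k + 1),
    (Nat.choose k j : ℝ) * (ichoose ((n : ℤ) - k - 1) ((j : ℤ) - 1) : ℝ) *
      p1 ^ k * ((1 - p1) / p2) ^ j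

/-- The partition function of the 2-NED on a ring of `n ≥ 1` sites,
`Z_{n,2} = ∑_{β ∈ Ω} p1^{N₁(β)} ((1-p1)/p2)^{N_{01}(β)}` (with value `2` at `n = 0`). -/
noncomputable def Zpart2 (p1 p2 : ℝ) (n : ℕ) : ℝ :=
  if h : n = 0 then 2
  else
    haveI : NeZero n := ⟨h⟩
    ∑ β : ZMod n → Bool, p1 ^ nedN1 n β * ((1 - p1) / p2) ^ nedN0r1 n 1 β

theorem multChain_cons {t : ℕ} (k x₀ : ℕ) (x : Fin t → ℕ) (N : ℕ) :
    multChain k (Fin.cons x₀ x : Fin (t + 1) → ℕ) N =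
      k.choose x₀ * multChain (k - x₀) x N := by
  simp [multChain, Fin.prod_univ_succ, Fin.sum_univ_succ, sum_filter, Nat.sub_sub, mul_assoc]

theorem sum_piFinset_const_succ {R : Type*} [AddCommMonoid R] {t : ℕ} (s : Finset ℕ)
    (f : (Fin (t + 1) → ℕ) → R) :
    ∑ x ∈ Fintype.piFinset (fun _ : Fin (t + 1) => s), f x =
      ∑ x₀ ∈ s, ∑ x ∈ Fintype.piFinset (fun _ : Fin t => s), f (Fin.cons x₀ x) := by
  rw [← sum_product']
  symm
  refine sum_equiv (Fin.consEquiv fun _ => ℕ) ?_ ?_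
  · rintro ⟨x₀, x⟩
    simp [Fin.consEquiv, Fintype.mem_piFinset, Fin.forall_fin_succ]
  · rintro ⟨x₀, x⟩ -
    rfl

/-- Iterated multinomial theorem, with coefficients in the form of `multChain`. -/
theorem pow_eq_sum_multChain {R : Type*} [CommSemiring R] {t : ℕ} (a : Fin t → R) (b : R)
    {k K L : ℕ} (hK : k ≤ K) (hL : k ≤ L) :
    (∑ j, a j + (1 + b)) ^ k =
      ∑ x ∈ Fintype.piFinset (fun _ : Fin t => range (K + 1)), ∑ N ∈ range (L + 1),
        (multChain k x N : R) * (∏ j, a j ^ x j) * b ^ N := by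
  induction t generalizing k with
  | zero =>
    rw [Finset.univ_eq_empty, sum_empty, zero_add, add_comm, add_pow]
    simp only [Fintype.piFinset_of_isEmpty, multChain, univ_eq_empty, prod_empty, sum_empty,
      one_mul, mul_one, one_pow, univ_unique, sum_singleton, Nat.sub_zero]
    rw [← sum_subset (range_subset_range.2 (Nat.succ_le_succ hL))]
    · exact sum_congr rfl fun N _ => mul_comm _ _
    · intro N _ hN
      rw [Nat.choose_eq_zero_of_lt (by simpa using hN)]
      simp
  | succ t ih =>
    rw [Fin.sum_univ_succ, add_assoc, add_pow, sum_piFinset_const_succ,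
      ← sum_subset (range_subset_range.2 (Nat.succ_le_succ hK))]
    · refine sum_congr rfl fun x₀ _ => ?_
      rw [ih (fun j => a j.succ) ((Nat.sub_le k x₀).trans hK) ((Nat.sub_le k x₀).trans hL),
        mul_sum, sum_mul]
      refine sum_congr rfl fun x _ => ?_
      rw [mul_sum, sum_mul]
      refine sum_congr rfl fun N _ => ?_
      rw [multChain_cons, Fin.prod_univ_succ]
      simp only [Fin.cons_zero, Fin.cons_succ, Nat.cast_mul]
      ring
    · intro x₀ _ hx
      refine sum_eq_zero fun x _ => sum_eq_zero fun N _ => ?_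
      rw [multChain_cons, Nat.choose_eq_zero_of_lt (by simpa using hx)]
      simp

/-- Read the word `f`, starting after `g` consecutive zeros: each `1`, as well as a final `1`
appended to the word, contributes `c r`, where `r` is the number of zeros just before it. -/
def scanWeight {R : Type*} [Mul R] (c : ℕ → R) : (L : ℕ) → ℕ → (Fin L → Bool) → R
  | 0, g, _ => c g
  | L + 1, g, f =>
    if f 0 then c g * scanWeight c L 0 (Fin.tail f) else scanWeight c L (g + 1) (Fin.tail f)

/-- The sum of `scanWeight` over all words of length `L`. -/
def scanSum {R : Type*} [CommSemiring R] (c : ℕ → R) (L g : ℕ) : R :=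
  ∑ f : Fin L → Bool, scanWeight c L g f

theorem scanSum_zero {R : Type*} [CommSemiring R] (c : ℕ → R) (g : ℕ) :
    scanSum c 0 g = c g := by
  simp [scanSum, scanWeight]

theorem scanSum_succ {R : Type*} [CommSemiring R] (c : ℕ → R) (L g : ℕ) :
    scanSum c (L + 1) g = c g * scanSum c L 0 + scanSum c L (g + 1) := by
  rw [scanSum, ← (Fin.consEquiv fun _ => Bool).sum_comp, Fintype.sum_prod_type, Fintype.sum_bool]
  simp [scanWeight, Fin.consEquiv, scanSum, mul_sum]

theorem scanSum_eq_sum {R : Type*} [CommSemiring R] (c : ℕ → R) (L g : ℕ) :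
    scanSum c L g = c (g + L) + ∑ j ∈ range L, c (g + j) * scanSum c (L - 1 - j) 0 := by
  induction L generalizing g with
  | zero => simp [scanSum_zero]
  | succ L ih =>
    rw [scanSum_succ, ih (g + 1), sum_range_succ', add_right_comm g 1 L, add_assoc g L 1]
    have h : ∀ j ∈ range L, c (g + 1 + j) * scanSum c (L - 1 - j) 0 =
        c (g + (j + 1)) * scanSum c (L + 1 - 1 - (j + 1)) 0 := fun j _ => by
      rw [add_right_comm g 1 j, add_assoc g j 1, Nat.add_sub_cancel, Nat.sub_sub, add_comm 1 j]
    rw [sum_congr rfl h]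
    simp only [add_zero, Nat.add_sub_cancel, Nat.sub_zero]
    ring

/-- A word is cut by its ones into gaps: the renewal equation solved by powers. -/
theorem scanSum_eq_sum_coeff {R : Type*} [CommRing R] (c : ℕ → R) (L : ℕ) :
    scanSum c L 0 =
      ∑ k ∈ Icc 1 (L + 1), PowerSeries.coeff (L + 1 - k) (PowerSeries.mk c ^ k) := by
  set A : PowerSeries R := PowerSeries.mk fun L => scanSum c L 0 with hA
  set Y : PowerSeries R := PowerSeries.X * PowerSeries.mk c with hY
  have hrec : A = PowerSeries.mk c + PowerSeries.X * (PowerSeries.mk c * A) := by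
    ext L
    cases L with
    | zero => simp [hA, scanSum_zero]
    | succ L =>
      rw [map_add, PowerSeries.coeff_succ_X_mul, PowerSeries.coeff_mul,
        Nat.sum_antidiagonal_eq_sum_range_succ
          (fun i j => PowerSeries.coeff i (PowerSeries.mk c) * PowerSeries.coeff j A)]
      simp only [hA, PowerSeries.coeff_mk]
      rw [scanSum_eq_sum]
      simp
  have hB : ∀ K : ℕ, 1 + PowerSeries.X * A =
      ∑ k ∈ range K, Y ^ k + Y ^ K * (1 + PowerSeries.X * A) := by
    intro K
    induction K with
    | zero => simp
    | succ K ih =>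
      have h1 : 1 + PowerSeries.X * A = 1 + Y * (1 + PowerSeries.X * A) := by
        conv_lhs => rw [hrec]
        rw [hY]; ring
      rw [sum_range_succ, pow_succ, add_assoc]
      conv_lhs => rw [ih]
      conv_lhs => enter [2]; rw [h1]
      ring
  have h := congrArg (PowerSeries.coeff (L + 1)) (hB (L + 2))
  have hYk : ∀ k, Y ^ k = PowerSeries.X ^ k * PowerSeries.mk c ^ k := fun k => mul_pow _ _ _
  rw [map_add, map_add, map_sum, PowerSeries.coeff_succ_X_mul, hYk (L + 2), mul_assoc,
    PowerSeries.coeff_X_pow_mul', if_neg (by omega), sum_range_succ'] at h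
  simp only [hA, PowerSeries.coeff_mk, PowerSeries.coeff_one, pow_zero, Nat.succ_ne_zero,
    if_false, zero_add, add_zero] at h
  rw [h, range_eq_Ico, sum_Ico_add' (fun k => PowerSeries.coeff (L + 1) (Y ^ k)) 0 (L + 1) 1]
  refine sum_congr rfl fun k hk => ?_
  rw [hYk, PowerSeries.coeff_X_pow_mul', if_pos (mem_Icc.1 hk).2]

/-- The number of consecutive zeros just before the site `i + 2`, counted from the site `1`. -/
def zerosBefore {n : ℕ} (β : ZMod n → Bool) : ℕ → ℕ
  | 0 => 0
  | i + 1 => if β ((i : ZMod n) + 2) then 0 else zerosBefore β i + 1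

theorem le_zerosBefore_iff {n : ℕ} {β : ZMod n → Bool} (hβ : β 1 = true) (i r : ℕ) :
    r ≤ zerosBefore β i ↔ ∀ j < r, β ((i : ZMod n) + 1 - j) = false := by
  induction i generalizing r with
  | zero =>
    cases r with
    | zero => simp
    | succ r =>
      refine iff_of_false (by simp [zerosBefore]) fun h => ?_
      simpa [hβ] using h 0 r.succ_pos
  | succ i ih =>
    cases r with
    | zero => simp
    | succ r =>
      have h2 : ((i + 1 : ℕ) : ZMod n) + 1 = i + 2 := by push_cast; ring
      have h3 : ∀ j : ℕ, (i : ZMod n) + 2 - (j + 1 : ℕ) = i + 1 - j := fun j => by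
        push_cast; ring
      rw [Nat.forall_lt_succ_left', h2]
      simp only [h3, zerosBefore]
      cases h : β ((i : ZMod n) + 2)
      · simp [h, ih]
      · simp [h]

theorem sum_zmod_eq_sum_range {R : Type*} [AddCommMonoid R] (n : ℕ) [NeZero n]
    (f : ZMod n → R) : ∑ z, f z = ∑ i ∈ range n, f i := by
  obtain ⟨L, rfl⟩ := Nat.exists_eq_succ_of_ne_zero (NeZero.ne n)
  rw [← Fin.sum_univ_eq_sum_range (fun i => f i)]
  exact Finset.sum_congr rfl fun z _ => congrArg f (ZMod.natCast_zmod_val (n := L + 1) z).symm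

theorem card_filter_zmod_eq (n : ℕ) [NeZero n] (P : ZMod n → Prop) [DecidablePred P]
    (a : ZMod n) : #{z | P z} = #((range n).filter fun i : ℕ => P ((i : ZMod n) + a)) := by
  rw [card_filter, card_filter, ← Equiv.sum_comp (Equiv.addRight a), sum_zmod_eq_sum_range]
  rfl

theorem nedN1_eq {n : ℕ} [NeZero n] (β : ZMod n → Bool) :
    nedN1 n β = #((range n).filter fun i : ℕ => β ((i : ZMod n) + 2) = true) :=
  card_filter_zmod_eq n _ 2

theorem forall_fin_zeros_iff {n : ℕ} (β : ZMod n → Bool) (z : ZMod n) (r : ℕ) :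
    (∀ j : Fin r, β (z - r + (j.val : ZMod n)) = false) ↔
      ∀ j < r, β (z - 1 - j) = false := by
  have h : ∀ j < r, z - r + ((r - 1 - j : ℕ) : ZMod n) = z - 1 - j := fun j hj => by
    rw [Nat.cast_sub (by omega), Nat.cast_sub (by omega)]
    push_cast; ring
  constructor
  · intro H j hj
    simpa [h j hj] using H ⟨r - 1 - j, by omega⟩
  · intro H j
    have h' := h (r - 1 - j) (by omega)
    rw [show r - 1 - (r - 1 - (j : ℕ)) = j by omega] at h'
    rw [h']
    exact H _ (by omega)

theorem nedN0r1_eq {n : ℕ} [NeZero n] {β : ZMod n → Bool} (hβ : β 1 = true) (r : ℕ) :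
    nedN0r1 n r β =
      #((range n).filter fun i : ℕ => β ((i : ZMod n) + 2) = true ∧ r ≤ zerosBefore β i) := by
  rw [nedN0r1, card_filter_zmod_eq n _ (2 - r)]
  congr 1
  refine filter_congr fun i _ => ?_
  have h1 : (i : ZMod n) + (2 - r) = i + 2 - r := by ring
  have h2 : (i : ZMod n) + 2 - 1 = i + 1 := by ring
  rw [le_zerosBefore_iff hβ, h1, forall_fin_zeros_iff, sub_add_cancel, h2, and_comm]

theorem nedN10r1_eq {n : ℕ} [NeZero n] {β : ZMod n → Bool} (hβ : β 1 = true) (r : ℕ) :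
    nedN10r1 n r β =
      #((range n).filter fun i : ℕ => β ((i : ZMod n) + 2) = true ∧ zerosBefore β i = r) := by
  rw [nedN10r1, card_filter_zmod_eq n _ (1 - r)]
  congr 1
  refine filter_congr fun i _ => ?_
  have h1 : ∀ j : ℕ, (i : ZMod n) + (1 - r) + ((j + 1 : ℕ) : ZMod n) = i + 2 - r + j :=
    fun j => by push_cast; ring
  have h2 : (i : ZMod n) + 2 - 1 = i + 1 := by ring
  have h3 : (i : ZMod n) + (1 - r) = i + 1 - r := by ring
  have h4 : zerosBefore β i = r ↔ r ≤ zerosBefore β i ∧ ¬ r + 1 ≤ zerosBefore β i := by omega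
  simp only [h1]
  rw [h4, le_zerosBefore_iff hβ, le_zerosBefore_iff hβ, forall_fin_zeros_iff, sub_add_cancel, h2,
    h3, Nat.forall_lt_succ_right]
  cases β ((i : ZMod n) + 1 - r)
  · simp
  · simp [and_comm]

/-- The contribution of a gap of `r` zeros to the stationary weight `nedW`. -/
noncomputable def gapWeight (m : ℕ) (p1 p2 : ℝ) (r : ℕ) : ℝ :=
  (1 - p1) ^ min r (m - 1) * if m - 1 ≤ r then p2⁻¹ else 1

theorem nedW_eq_prod {n m : ℕ} [NeZero n] (hm : 2 ≤ m) (p1 p2 : ℝ) {β : ZMod n → Bool}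
    (hβ : β 1 = true) :
    nedW n m p1 p2 β = ∏ i ∈ range n,
      if β ((i : ZMod n) + 2) then p1 * gapWeight m p1 p2 (zerosBefore β i) else 1 := by
  have hmin : ∀ h : ℕ, min h (m - 1) =
      (∑ r ∈ Icc 1 (m - 2), r * if h = r then 1 else 0) +
        (m - 1) * if m - 1 ≤ h then 1 else 0 := by
    intro h
    simp only [mul_ite, mul_one, mul_zero, sum_ite_eq, mem_Icc]
    split_ifs <;> omega
  rw [← prod_filter]
  simp only [gapWeight, prod_mul_distrib, prod_const, prod_pow_eq_pow_sum, ← prod_filter]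
  rw [nedW, nedN1_eq, nedN0r1_eq hβ, sum_congr rfl fun r _ => by rw [nedN10r1_eq hβ r]]
  simp only [hmin, sum_add_distrib, ← mul_sum]
  rw [sum_comm]
  simp only [← mul_sum, ← card_filter, filter_filter, inv_pow, div_eq_mul_inv, mul_assoc]

theorem scanWeight_eq_prod {n : ℕ} {β : ZMod n → Bool} (hβ : β 1 = true) {R : Type*}
    [CommMonoid R] (c : ℕ → R) (L i : ℕ) (h : i + L + 1 = n) :
    scanWeight c L (zerosBefore β i) (fun j => β (((i + j : ℕ) : ZMod n) + 2)) =
      ∏ j ∈ range (L + 1),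
        if β (((i + j : ℕ) : ZMod n) + 2) then c (zerosBefore β (i + j)) else 1 := by
  induction L generalizing i with
  | zero =>
    have h1 : (i : ZMod n) + 2 = 1 := by
      have : ((i + 0 + 1 : ℕ) : ZMod n) = 0 := by rw [h]; simp
      push_cast at this
      linear_combination this
    simp [scanWeight, h1, hβ]
  | succ L ih =>
    have ih' := ih (i + 1) (by omega)
    rw [prod_range_succ']
    have htail : (Fin.tail fun j : Fin (L + 1) => β (((i + j : ℕ) : ZMod n) + 2)) =
        fun j : Fin L => β (((i + 1 + j : ℕ) : ZMod n) + 2) := by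
      funext j
      simp [Fin.tail, add_assoc, add_comm, add_left_comm]
    rw [scanWeight, htail]
    simp only [add_assoc, add_comm 1, Fin.val_zero, add_zero] at ih' ⊢
    rw [← ih']
    simp only [zerosBefore]
    cases β ((i : ZMod n) + 2) <;> simp [mul_comm]

theorem sum_nedW_eq_scanSum {n m : ℕ} [NeZero n] (hm : 2 ≤ m) (p1 p2 : ℝ) :
    ∑ β : ZMod n → Bool with β 1 = true, nedW n m p1 p2 β =
      scanSum (fun r => p1 * gapWeight m p1 p2 r) (n - 1) 0 := by
  obtain ⟨L, rfl⟩ : ∃ L, n = L + 1 := Nat.exists_eq_succ_of_ne_zero (NeZero.ne n)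
  have hf : ∀ β ∈ ({β : ZMod (L + 1) → Bool | β 1 = true} : Finset _),
      nedW (L + 1) m p1 p2 β = scanWeight (fun r => p1 * gapWeight m p1 p2 r) L 0
        (fun j => β (((j : ℕ) : ZMod (L + 1)) + 2)) := by
    intro β hβ
    have hβ : β 1 = true := by simpa using hβ
    rw [nedW_eq_prod hm _ _ hβ]
    simpa [zerosBefore] using
      (scanWeight_eq_prod hβ (fun r => p1 * gapWeight m p1 p2 r) L 0 (by omega)).symm
  rw [sum_congr rfl hf, Nat.add_sub_cancel, scanSum, sum_filter]
  let e : (Bool × (Fin L → Bool)) ≃ (ZMod (L + 1) → Bool) :=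
    (Fin.consEquiv fun _ => Bool).trans
      (Equiv.arrowCongr (Equiv.addRight (1 : ZMod (L + 1))) (Equiv.refl Bool))
  have he1 : ∀ b f, e (b, f) 1 = b := fun b f => by
    have : e (b, f) 1 = @Fin.cons L (fun _ => Bool) b f ((1 + -1 : ZMod (L + 1))) := rfl
    rw [this, add_neg_cancel]
    rfl
  have he2 : ∀ b f (j : Fin L), e (b, f) (((j : ℕ) : ZMod (L + 1)) + 2) = f j := fun b f j => by
    have : e (b, f) (((j : ℕ) : ZMod (L + 1)) + 2) =
        @Fin.cons L (fun _ => Bool) b f ((((j : ℕ) : ZMod (L + 1)) + 2 + -1 : ZMod (L + 1))) := rfl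
    have h2 : (((j : ℕ) : ZMod (L + 1)) + 2) + -1 = ((j.succ : ℕ) : ZMod (L + 1)) := by
      simp only [Fin.val_succ]; push_cast; ring
    have h3 : ((j.succ : ℕ) : ZMod (L + 1)) = j.succ := Fin.cast_val_eq_self j.succ
    rw [this, h2, h3]
    rfl
  rw [← e.sum_comp, Fintype.sum_prod_type, Fintype.sum_bool]
  simp [he1, he2]

theorem mk_gapWeight {m : ℕ} (hm : 2 ≤ m) (p1 p2 : ℝ) :
    PowerSeries.mk (gapWeight m p1 p2) =
      ∑ s : Fin (m - 2), (PowerSeries.C (1 - p1) * PowerSeries.X) ^ (s.val + 1) +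
        (1 + PowerSeries.C p2⁻¹ * (PowerSeries.C (1 - p1) * PowerSeries.X) ^ (m - 1) *
          PowerSeries.mk 1) := by
  rw [Fin.sum_univ_eq_sum_range
    (fun s => (PowerSeries.C (1 - p1) * PowerSeries.X : PowerSeries ℝ) ^ (s + 1))]
  ext d
  have h : (PowerSeries.C p2⁻¹ * (PowerSeries.C (1 - p1) * PowerSeries.X) ^ (m - 1) *
      PowerSeries.mk 1 : PowerSeries ℝ) = PowerSeries.C (p2⁻¹ * (1 - p1) ^ (m - 1)) *
        (PowerSeries.X ^ (m - 1) * PowerSeries.mk 1) := by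
    rw [mul_pow, map_mul, map_pow]; ring
  rw [h]
  simp only [map_add, map_sum, mul_pow, ← map_pow, PowerSeries.coeff_C_mul,
    PowerSeries.coeff_X_pow, PowerSeries.coeff_X_pow_mul', PowerSeries.coeff_one,
    PowerSeries.coeff_mk, Pi.one_apply, gapWeight]
  rcases Nat.eq_zero_or_pos d with rfl | hd
  · simp [show m - 1 ≠ 0 by omega]
  · obtain ⟨d, rfl⟩ : ∃ e, d = e + 1 := ⟨d - 1, by omega⟩
    by_cases hdm : m - 1 ≤ d + 1
    · rw [sum_eq_zero fun s hs => by
        rw [if_neg (by have := mem_range.1 hs; omega), mul_zero]]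
      simp [hdm, mul_comm]
    · rw [sum_eq_single d (fun s _ hs => by rw [if_neg (by omega), mul_zero])
        (fun hd' => absurd (mem_range.2 (by omega)) hd')]
      simp [hdm, min_eq_left (not_le.1 hdm).le]

theorem coeff_X_pow_mul_mk_one_pow {n m k : ℕ} (hm : 2 ≤ m) (hk : k ≤ n) (M N : ℕ) :
    PowerSeries.coeff (n - k)
        (PowerSeries.X ^ (M + (m - 1) * N) * PowerSeries.mk (1 : ℕ → ℝ) ^ N) =
      if (M, N) ∈ nedC n m k then
        (ichoose ((n : ℤ) - k - M - ((m : ℤ) - 2) * N - 1) ((N : ℤ) - 1) : ℝ)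
      else 0 := by
  obtain ⟨t, rfl⟩ : ∃ t, m = t + 2 := ⟨m - 2, by omega⟩
  have hmem : (M, N) ∈ nedC n (t + 2) k ↔
      if N = 0 then M = n - k else M + (t + 1) * N ≤ n - k := by
    simp only [nedC, mem_filter, mem_product, mem_range, show t + 2 - 1 = t + 1 by omega]
    cases N with
    | zero => simp; omega
    | succ N =>
      simp only [Nat.succ_ne_zero, if_false, false_iff]
      have h1 : (N + 1) * (t + 1) = (t + 1) * (N + 1) := mul_comm _ _
      have h2 : (t + 1) * (N + 1) = t * N + t + N + 1 := by ring
      rw [h1, h2]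
      generalize t * N = a
      omega
  rw [show t + 2 - 1 = t + 1 by omega]
  cases N with
  | zero =>
    simp only [hmem, mul_zero, add_zero, pow_zero, mul_one, PowerSeries.coeff_X_pow, if_true]
    by_cases h : M = n - k
    · have h' : (n : ℤ) - k - M = 0 := by omega
      simp [h.symm, ichoose, h']
    · simp [h, Ne.symm h]
  | succ N =>
    rw [PowerSeries.coeff_X_pow_mul', PowerSeries.mk_one_pow_eq_mk_choose_add]
    rw [if_neg N.succ_ne_zero] at hmem
    by_cases h : M + (t + 1) * (N + 1) ≤ n - k
    · obtain ⟨d, hd⟩ := Nat.exists_eq_add_of_le h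
      have ha : (n : ℤ) - k - M - ((t + 2 : ℕ) - 2) * (N + 1 : ℕ) - 1 = (N + d : ℕ) := by
        have hd' : (n : ℤ) - k = M + (t + 1) * (N + 1) + d := by
          rw [← Nat.cast_sub hk, hd]; push_cast; ring
        rw [hd']; push_cast; ring
      have hb : ((N + 1 : ℕ) : ℤ) - 1 = N := by push_cast; ring
      rw [if_pos h, if_pos (hmem.2 h), ha, hb, hd, Nat.add_sub_cancel_left, PowerSeries.coeff_mk,
        ichoose, if_neg (by omega), if_pos N.cast_nonneg, Int.toNat_natCast, Int.toNat_natCast]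
    · rw [if_neg h, if_neg (hmem.not.2 h)]


theorem coeff_mk_gapWeight_pow {n m k : ℕ} (hm : 2 ≤ m) (hk : k ≤ n) (p1 p2 : ℝ) :
    PowerSeries.coeff (n - k) (PowerSeries.mk (gapWeight m p1 p2) ^ k) =
      ∑ MN ∈ nedC n m k, ∑ x ∈ nedT m k MN.1,
        (multChain k x MN.2 : ℝ) *
          (ichoose ((n : ℤ) - k - MN.1 - ((m : ℤ) - 2) * MN.2 - 1) ((MN.2 : ℤ) - 1) : ℝ) *
          (1 - p1) ^ (MN.1 + (m - 1) * MN.2) / p2 ^ MN.2 := by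
  have hterm : ∀ (x : Fin (m - 2) → ℕ) (N : ℕ),
      (multChain k x N : PowerSeries ℝ) *
        (∏ s, ((PowerSeries.C (1 - p1) * PowerSeries.X) ^ (s.val + 1)) ^ x s) *
        (PowerSeries.C p2⁻¹ * (PowerSeries.C (1 - p1) * PowerSeries.X) ^ (m - 1) *
          PowerSeries.mk 1) ^ N =
      PowerSeries.C (multChain k x N * (1 - p1) ^ (∑ s, (s.val + 1) * x s + (m - 1) * N) /
          p2 ^ N) *
        (PowerSeries.X ^ (∑ s, (s.val + 1) * x s + (m - 1) * N) * PowerSeries.mk 1 ^ N) := by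
    intro x N
    simp only [← pow_mul, prod_pow_eq_pow_sum, div_eq_mul_inv, ← inv_pow, map_mul, map_pow,
      map_natCast]
    ring
  rw [mk_gapWeight hm, pow_eq_sum_multChain _ _ le_rfl hk]
  simp only [hterm, map_sum, PowerSeries.coeff_C_mul, coeff_X_pow_mul_mk_one_pow hm hk, mul_ite,
    mul_zero]
  rw [sum_comm]
  have hC : ∀ f : ℕ × ℕ → ℝ, ∑ MN ∈ nedC n m k, f MN =
      ∑ N ∈ range (n + 1), ∑ M ∈ range (n + 1), if (M, N) ∈ nedC n m k then f (M, N) else 0 := by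
    intro f
    rw [sum_comm, ← sum_product', ← sum_filter]
    refine sum_congr ?_ fun _ _ => rfl
    ext ⟨M, N⟩
    simp only [nedC, mem_filter]
    tauto
  rw [hC]
  refine sum_congr rfl fun N _ => ?_
  simp only [nedT, sum_filter]
  simp_rw [← sum_filter (fun M => (M, N) ∈ nedC n m k)]
  rw [sum_comm]
  refine sum_congr rfl fun x _ => ?_
  rw [sum_ite_eq]
  refine if_congr ?_ (by ring) rfl
  simp only [mem_filter, nedC, mem_product]
  tauto

/-- the unnormalized stationary density `Z_{n,m} · π(η₁ = 1)
= ∑_{β : β₁ = 1} W(β)` equals the explicit combinatorial sum. -/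
theorem ned_density_formula (n m : ℕ) [NeZero n] (hm : 2 ≤ m) (hmn : m ≤ n)
    (p1 p2 : ℝ) (hp1 : p1 ∈ Set.Ioo (0 : ℝ) 1) (hp2 : p2 ∈ Set.Ioc (0 : ℝ) 1) :
    nedZ n m p1 p2 *
        (∑ β ∈ (univ.filter fun β : ZMod n → Bool => β 1 = true),
          nedW n m p1 p2 β / nedZ n m p1 p2) =
      (∑ β ∈ (univ.filter fun β : ZMod n → Bool => β 1 = true), nedW n m p1 p2 β) ∧
    (∑ β ∈ (univ.filter fun β : ZMod n → Bool => β 1 = true), nedW n m p1 p2 β) =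
      ∑ k ∈ Finset.Icc 1 n, ∑ MN ∈ nedC n m k, ∑ x ∈ nedT m k MN.1,
        (multChain k x MN.2 : ℝ) *
          (ichoose ((n : ℤ) - k - MN.1 - ((m : ℤ) - 2) * MN.2 - 1) ((MN.2 : ℤ) - 1) : ℝ) *
          p1 ^ k * (1 - p1) ^ (MN.1 + (m - 1) * MN.2) / p2 ^ MN.2 := by
  have hq : 0 < 1 - p1 := sub_pos.2 hp1.2
  have hZ : 0 < nedZ n m p1 p2 :=
    sum_pos (fun β _ => div_pos (mul_pos (pow_pos hp1.1 _) (pow_pos hq _)) (pow_pos hp2.1 _))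
      univ_nonempty
  refine ⟨by rw [← sum_div, mul_div_cancel₀ _ hZ.ne'], ?_⟩
  have hn : n - 1 + 1 = n := Nat.sub_add_cancel (NeZero.one_le)
  have hmk : PowerSeries.mk (fun r => p1 * gapWeight m p1 p2 r) =
      PowerSeries.C p1 * PowerSeries.mk (gapWeight m p1 p2) := by
    ext d
    simp
  rw [sum_nedW_eq_scanSum hm, scanSum_eq_sum_coeff, hn, hmk]
  refine sum_congr rfl fun k hk => ?_
  rw [mul_pow, ← map_pow, PowerSeries.coeff_C_mul,
    coeff_mk_gapWeight_pow hm (mem_Icc.1 hk).2, mul_sum]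
  refine sum_congr rfl fun MN _ => ?_
  rw [mul_sum]
  exact sum_congr rfl fun x _ => by ring
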